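/- Let p>1, Q>1, and let q₀ = 1/s⁺_p(Q). Then on the real line with Lebesgue measure the range 1 ≤ q < q₀ in the self-improvement RH_p ⊂ RH_q is sharp: there exists a weight w on ℝ with [w]_{RH_p} = Q and [w]_{RH_{q₀}} = ∞, i.e. w ∉ RH_{q₀}. -/

import Mathlib

open MeasureTheory Set Filter

noncomputable section

/-- Average of `f` over the interval `(a,b)` with respect to Lebesgue measure. -/
def intAvg (a b : ℝ) (f : ℝ → ℝ) : ℝ := ⨍ x in Ioo a b, f x

/-- The `A_p` characteristic quantity `⟨w⟩_I ⟨w^{-1/(p-1)}⟩_I^{p-1}` of `w` on `I = (a,b)`. -/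
def ApChar (w : ℝ → ℝ) (p a b : ℝ) : ℝ :=
  intAvg a b w * (intAvg a b fun x => w x ^ (-1 / (p - 1))) ^ (p - 1)

/-- The `RH_p` characteristic quantity `⟨w^p⟩_I^{1/p} ⟨w⟩_I^{-1}` of `w` on `I = (a,b)`. -/
def RHChar (w : ℝ → ℝ) (p a b : ℝ) : ℝ :=
  (intAvg a b fun x => w x ^ p) ^ (1 / p) * (intAvg a b w)⁻¹

/-- `[w]_p ≤ C` on the real line (with the requisite integrability on every interval). -/
def MemAp (w : ℝ → ℝ) (p C : ℝ) : Prop :=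
  ∀ a b : ℝ, a < b →
    IntegrableOn w (Ioo a b) ∧ IntegrableOn (fun x => w x ^ (-1 / (p - 1))) (Ioo a b) ∧
    ApChar w p a b ≤ C

/-- `[w]_{RH_p} ≤ C` on the real line (with the requisite integrability on every interval). -/
def MemRH (w : ℝ → ℝ) (p C : ℝ) : Prop :=
  ∀ a b : ℝ, a < b →
    IntegrableOn w (Ioo a b) ∧ IntegrableOn (fun x => w x ^ p) (Ioo a b) ∧
    RHChar w p a b ≤ C

/-- The reverse Hölder inequality `⟨F ^ p⟩ ≤ K * ⟨F⟩ ^ p` on the interval `(a, b)`. -/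
def RHOn (p K : ℝ) (F : ℝ → ℝ) (a b : ℝ) : Prop :=
  (∫ x in a..b, F x ^ p) / (b - a) ≤ K * ((∫ x in a..b, F x) / (b - a)) ^ p

lemma RHOn.congr {p K a b : ℝ} {F G : ℝ → ℝ} (hF : RHOn p K F a b) (hab : a ≤ b)
    (h : ∀ x ∈ Ioc a b, F x = G x) : RHOn p K G a b := by
  have h1 : ∫ x in a..b, G x = ∫ x in a..b, F x := by
    refine intervalIntegral.integral_congr_ae (Eventually.of_forall fun x hx => ?_)
    rw [uIoc_of_le hab] at hx
    exact (h x hx).symm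
  have h2 : ∫ x in a..b, G x ^ p = ∫ x in a..b, F x ^ p := by
    refine intervalIntegral.integral_congr_ae (Eventually.of_forall fun x hx => ?_)
    rw [uIoc_of_le hab] at hx
    simp only [h x hx]
  rw [RHOn, h1, h2]
  exact hF

lemma RHOn.comp_mul_sub {p K a b c d : ℝ} {F : ℝ → ℝ} (hc : 0 < c)
    (h : RHOn p K F (c * a - d) (c * b - d)) : RHOn p K (fun x => F (c * x - d)) a b := by
  rw [RHOn] at h ⊢
  rw [intervalIntegral.integral_comp_mul_sub (fun x => F x) hc.ne',
    intervalIntegral.integral_comp_mul_sub (fun x => F x ^ p) hc.ne']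
  have e : c * b - d - (c * a - d) = c * (b - a) := by ring
  rw [e] at h
  simp only [smul_eq_mul]
  rwa [← div_eq_inv_mul, ← div_eq_inv_mul, div_div, div_div]

lemma RHOn.const_mul {p K a b l : ℝ} {F : ℝ → ℝ} (hl : 0 < l) (hF : ∀ x, 0 ≤ F x) (hab : a ≤ b)
    (h : RHOn p K F a b) : RHOn p K (fun x => l * F x) a b := by
  rw [RHOn] at h ⊢
  have e : ∀ x, (l * F x) ^ p = l ^ p * F x ^ p := fun x => Real.mul_rpow hl.le (hF x)
  simp only [e, intervalIntegral.integral_const_mul]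
  have h0 : 0 ≤ (∫ x in a..b, F x) / (b - a) :=
    div_nonneg (intervalIntegral.integral_nonneg hab fun x _ => hF x) (by linarith)
  rw [mul_div_assoc, mul_div_assoc, Real.mul_rpow hl.le h0]
  have := mul_le_mul_of_nonneg_left h (Real.rpow_nonneg hl.le p)
  linarith

lemma intervalIntegrable_of_bounded {F : ℝ → ℝ} (hF : Measurable F) {C : ℝ}
    (hC : ∀ x, |F x| ≤ C) (a b : ℝ) : IntervalIntegrable F volume a b := by
  rw [intervalIntegrable_iff]
  exact Measure.integrableOn_of_bounded (M := C) (by simp) hF.aestronglyMeasurable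
    (Eventually.of_forall fun x => by simpa using hC x)

/-- Affine minorants of `t ↦ K * t ^ p` certify the reverse Hölder inequality. -/
lemma RHOn.of_affine {p K A B a b : ℝ} {F : ℝ → ℝ} (hab : a < b)
    (hlin : ∀ t, 0 ≤ t → A * t - B ≤ K * t ^ p) (hF : ∀ x, 0 ≤ F x)
    (h1 : IntervalIntegrable F volume a b)
    (hp : IntervalIntegrable (fun x => F x ^ p) volume a b)
    (h : ∫ x in a..b, (F x ^ p - A * F x + B) ≤ 0) : RHOn p K F a b := by
  have e : ∫ x in a..b, (F x ^ p - A * F x + B) =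
      (∫ x in a..b, F x ^ p) - A * (∫ x in a..b, F x) + (b - a) * B := by
    rw [intervalIntegral.integral_add (hp.sub (h1.const_mul A)) (by simp),
      intervalIntegral.integral_sub hp (h1.const_mul A)]
    simp
  rw [e] at h
  have hba : 0 < b - a := sub_pos.2 hab
  have h0 : 0 ≤ (∫ x in a..b, F x) / (b - a) :=
    div_nonneg (intervalIntegral.integral_nonneg hab.le fun x _ => hF x) hba.le
  refine le_trans ?_ (hlin _ h0)
  rw [div_le_iff₀ hba, sub_mul, mul_assoc, div_mul_cancel₀ _ hba.ne']
  linarith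

/-- If every cell `(k - 1/2, k + 1/2)` contributes at most `0` and every part of a cell
contributes at most `e`, then every interval contributes at most `2 * e`. -/
lemma integral_le_of_cells {h : ℝ → ℝ} {e : ℝ} (hi : ∀ a b, IntervalIntegrable h volume a b)
    (hcell : ∀ k : ℤ, ∫ x in (k - 1 / 2 : ℝ)..(k + 1 / 2), h x ≤ 0)
    (hpart : ∀ (k : ℤ) (c d : ℝ), (k - 1 / 2 : ℝ) ≤ c → c ≤ d → d ≤ k + 1 / 2 →
      ∫ x in c..d, h x ≤ e) {a b : ℝ} (hab : a ≤ b) : ∫ x in a..b, h x ≤ 2 * e := by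
  have he : 0 ≤ e := by simpa using hpart 0 0 0 (by norm_num) le_rfl (by norm_num)
  have hchain : ∀ (k : ℤ) (n : ℕ), ∫ x in (k - 1 / 2 : ℝ)..(k + n - 1 / 2), h x ≤ 0 := by
    intro k n
    induction n with
    | zero => simp
    | succ n ih =>
      rw [← intervalIntegral.integral_add_adjacent_intervals (hi _ (k + n - 1 / 2)) (hi _ _)]
      have := hcell (k + n)
      push_cast at this ⊢
      rw [show (k + (n + 1) - 1 / 2 : ℝ) = k + n + 1 / 2 by ring]
      linarith
  set i := ⌊a + 1 / 2⌋
  set j := ⌊b + 1 / 2⌋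
  have hi1 : (i : ℝ) ≤ a + 1 / 2 := Int.floor_le _
  have hi2 : a + 1 / 2 < i + 1 := Int.lt_floor_add_one _
  have hj1 : (j : ℝ) ≤ b + 1 / 2 := Int.floor_le _
  have hj2 : b + 1 / 2 < j + 1 := Int.lt_floor_add_one _
  have hij : i ≤ j := Int.floor_le_floor (by linarith)
  rcases hij.eq_or_lt with hij | hij
  · rw [← hij] at hj2
    linarith [hpart i a b (by linarith) hab (by linarith)]
  · obtain ⟨n, hn⟩ := Int.eq_ofNat_of_zero_le (show 0 ≤ j - (i + 1) by omega)
    have hn' : (j : ℝ) = i + 1 + n := by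
      have : j = i + 1 + n := by omega
      exact_mod_cast this
    have h1 := hpart i a (i + 1 / 2) (by linarith) (by linarith) le_rfl
    have h2 := hchain (i + 1) n
    have h3 := hpart j (j - 1 / 2) b le_rfl (by linarith) (by linarith)
    push_cast at h2
    rw [show (i + 1 - 1 / 2 : ℝ) = i + 1 / 2 by ring, ← hn'] at h2
    rw [← intervalIntegral.integral_add_adjacent_intervals (hi _ (i + 1 / 2)) (hi _ _),
      ← intervalIntegral.integral_add_adjacent_intervals (hi (i + 1 / 2) (j - 1 / 2)) (hi _ _)]
    linarith

/-- The function equal to `F k (x - k)` on the cell of half-width `1/2` around each integer `k`. -/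
def tile (F : ℤ → ℝ → ℝ) (x : ℝ) : ℝ := F ⌊x + 1 / 2⌋ (x - ⌊x + 1 / 2⌋)

lemma tile_eq {F : ℤ → ℝ → ℝ} {v : ℝ} (hF : ∀ k y, 1 / 2 ≤ |y| → F k y = v) {k : ℤ} {x : ℝ}
    (hx : |x - k| ≤ 1 / 2) : tile F x = F k (x - k) := by
  rw [tile]
  by_cases hk : ⌊x + 1 / 2⌋ = k
  · rw [hk]
  · have h1 : 1 ≤ |((⌊x + 1 / 2⌋ : ℤ) : ℝ) - k| := by
      have := Int.one_le_abs (sub_ne_zero.2 hk)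
      exact_mod_cast this
    have h2 : |x - ⌊x + 1 / 2⌋| ≤ 1 / 2 := by
      rw [abs_le]
      constructor <;> linarith [Int.floor_le (x + 1 / 2), Int.lt_floor_add_one (x + 1 / 2)]
    have h3 := abs_sub_le (⌊x + 1 / 2⌋ : ℝ) x k
    rw [abs_sub_comm (⌊x + 1 / 2⌋ : ℝ) x] at h3
    rw [hF _ _ (by linarith), hF _ _ (by linarith)]

lemma measurable_tile {F : ℤ → ℝ → ℝ} (hF : ∀ k, Measurable (F k)) : Measurable (tile F) := by
  have h : Measurable (fun q : ℤ × ℝ => F q.1 q.2) :=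
    measurable_from_prod_countable_right fun k => hF k
  have hfl : Measurable fun x : ℝ => ⌊x + 1 / 2⌋ := by fun_prop
  have hfr : Measurable fun x : ℝ => x - (⌊x + 1 / 2⌋ : ℝ) := by fun_prop
  exact h.comp (hfl.prodMk hfr)

/-- The function `l * f` on `2 * N + 1` consecutive cells, extended by `1`. -/
def pulse (N : ℕ) (f : ℝ → ℝ) (l x : ℝ) : ℝ :=
  if x ∈ Ioc (-(N + 1 / 2 : ℝ)) (N + 1 / 2) then l * f x else 1

lemma measurable_pulse {N : ℕ} {f : ℝ → ℝ} {l : ℝ} (hf : Measurable f) :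
    Measurable (pulse N f l) :=
  Measurable.ite measurableSet_Ioc (by fun_prop) measurable_const

lemma one_le_pulse {N : ℕ} {f : ℝ → ℝ} {l : ℝ} (hl : 1 ≤ l) (hf : ∀ x, 1 ≤ f x) (x : ℝ) :
    1 ≤ pulse N f l x := by
  rw [pulse]
  split_ifs
  · nlinarith [hf x]
  · exact le_rfl

lemma pulse_le {N : ℕ} {f : ℝ → ℝ} {l C : ℝ} (hl : 1 ≤ l) (hf : ∀ x, 1 ≤ f x)
    (hC : ∀ x, f x ≤ C) (x : ℝ) : pulse N f l x ≤ l * C := by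
  have h1 := hf x
  have h2 := hC x
  rw [pulse]
  split_ifs <;> nlinarith

lemma mem_Ioc_iff_natAbs_le {N : ℕ} {k : ℤ} {x : ℝ} (hx : x ∈ Ioc (k - 1 / 2 : ℝ) (k + 1 / 2)) :
    x ∈ Ioc (-(N + 1 / 2 : ℝ)) (N + 1 / 2) ↔ k.natAbs ≤ N := by
  obtain ⟨h1, h2⟩ := hx
  constructor
  · rintro ⟨h3, h4⟩
    have h5 : (k : ℝ) < N + 1 := by linarith
    have h6 : (-(N + 1) : ℝ) < k := by linarith
    have h5' : k < N + 1 := by exact_mod_cast h5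
    have h6' : -((N : ℤ) + 1) < k := by exact_mod_cast h6
    omega
  · intro h
    have h5' : k ≤ N := by omega
    have h6' : -(N : ℤ) ≤ k := by omega
    have h5 : (k : ℝ) ≤ N := by exact_mod_cast h5'
    have h6 : (-N : ℝ) ≤ k := by exact_mod_cast h6'
    constructor <;> linarith

lemma integral_cells {h : ℝ → ℝ} {v : ℝ} (hi : ∀ a b, IntervalIntegrable h volume a b)
    (hcell : ∀ k : ℤ, ∫ x in (k - 1 / 2 : ℝ)..(k + 1 / 2), h x = v) (N : ℕ) :
    ∫ x in (-(N + 1 / 2 : ℝ))..(N + 1 / 2), h x = (2 * N + 1) * v := by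
  induction N with
  | zero => simpa [neg_div] using hcell 0
  | succ n ih =>
    have h1 := hcell (n + 1)
    have h2 := hcell (-(n + 1))
    push_cast at h1 h2 ⊢
    rw [show ((n : ℝ) + 1 - 1 / 2) = n + 1 / 2 by ring] at h1
    rw [show (-((n : ℝ) + 1) - 1 / 2) = -(n + 1 + 1 / 2) by ring,
      show (-((n : ℝ) + 1) + 1 / 2) = -(n + 1 / 2) by ring] at h2
    rw [← intervalIntegral.integral_add_adjacent_intervals (hi _ (-(n + 1 / 2))) (hi _ _),
      ← intervalIntegral.integral_add_adjacent_intervals (hi (-(n + 1 / 2)) (n + 1 / 2)) (hi _ _),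
      h1, h2, ih]
    ring

lemma integral_ite_Ioc {h : ℝ → ℝ} {v r R : ℝ} (hi : ∀ a b, IntervalIntegrable h volume a b)
    (hr : 0 ≤ r) (hrR : r ≤ R) :
    ∫ x in (-R)..R, (if x ∈ Ioc (-r) r then h x else v) =
      (∫ x in (-r)..r, h x) + (2 * R - 2 * r) * v := by
  set T : ℝ → ℝ := fun x => if x ∈ Ioc (-r) r then h x else v with hT
  have e1 : ∀ x ∈ uIoc (-R) (-r), v = T x := by
    intro x hx
    rw [uIoc_of_le (by linarith)] at hx
    exact (if_neg fun hx' => by linarith [hx.2, hx'.1]).symm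
  have e2 : ∀ x ∈ uIoc (-r) r, h x = T x := by
    intro x hx
    rw [uIoc_of_le (by linarith)] at hx
    exact (if_pos hx).symm
  have e3 : ∀ x ∈ uIoc r R, v = T x := by
    intro x hx
    rw [uIoc_of_le (by linarith)] at hx
    exact (if_neg fun hx' => by linarith [hx.1, hx'.2]).symm
  have i1 : IntervalIntegrable T volume (-R) (-r) :=
    (intervalIntegrable_const (c := v)).congr e1
  have i2 : IntervalIntegrable T volume (-r) r := (hi _ _).congr e2
  have i3 : IntervalIntegrable T volume r R := (intervalIntegrable_const (c := v)).congr e3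
  rw [← intervalIntegral.integral_add_adjacent_intervals (i1.trans i2) i3,
    ← intervalIntegral.integral_add_adjacent_intervals i1 i2,
    ← intervalIntegral.integral_congr_ae (Eventually.of_forall e1),
    ← intervalIntegral.integral_congr_ae (Eventually.of_forall e2),
    ← intervalIntegral.integral_congr_ae (Eventually.of_forall e3)]
  simp
  ring

/-- A bounded function `f ≥ 1` with moments `m` on every unit cell around an integer, such that
all the functions `pulse N f l` satisfy the reverse Hölder inequality with constant `K`. -/
structure IsCellular (p K l : ℝ) (m : ℝ → ℝ) (f : ℝ → ℝ) : Prop where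
  measurable : Measurable f
  one_le : ∀ x, 1 ≤ f x
  bdd : ∃ C, ∀ x, f x ≤ C
  moment : ∀ (k : ℤ) (q : ℝ), ∫ x in (k - 1 / 2 : ℝ)..(k + 1 / 2), f x ^ q = m q
  rh : ∀ (N : ℕ) (a b : ℝ), a < b → RHOn p K (pulse N f l) a b

lemma intervalIntegrable_rpow {f : ℝ → ℝ} (hf : Measurable f) (h1 : ∀ x, 1 ≤ f x)
    (hb : ∃ C, ∀ x, f x ≤ C) (q a b : ℝ) :
    IntervalIntegrable (fun x => f x ^ q) volume a b := by
  obtain ⟨C, hC⟩ := hb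
  refine intervalIntegrable_of_bounded (C := max 1 (C ^ q)) (by fun_prop) (fun x => ?_) a b
  have h0 : 0 ≤ f x := by linarith [h1 x]
  rw [abs_of_nonneg (Real.rpow_nonneg h0 q)]
  rcases le_total 0 q with hq | hq
  · exact le_max_of_le_right (Real.rpow_le_rpow h0 (hC x) hq)
  · exact le_max_of_le_left (Real.rpow_le_one_of_one_le_of_nonpos (h1 x) hq)

lemma IsCellular.of_one {p K l A B : ℝ} (hl : 1 < l)
    (hlin : ∀ t, 0 ≤ t → A * t - B ≤ K * t ^ p) (hone : 1 ≤ A - B)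
    (hinv : (l⁻¹) ^ p ≤ A * l⁻¹ - B) : IsCellular p K l (fun _ => 1) (fun _ => 1) where
  measurable := measurable_const
  one_le _ := le_rfl
  bdd := ⟨1, fun _ => le_rfl⟩
  moment k q := by norm_num
  rh N a b hab := by
    have hl0 : 0 < l := by linarith
    have hm : Measurable (pulse N (fun _ => 1) l) := measurable_pulse measurable_const
    have h1 := fun x => one_le_pulse (N := N) (f := fun _ => 1) hl.le (fun _ => le_rfl) x
    have hC := fun x => pulse_le (N := N) (f := fun _ => 1) hl.le (fun _ => le_rfl)
      (fun _ => le_rfl) x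
    have hG : ∀ x, l⁻¹ * pulse N (fun _ => 1) l x = 1 ∨ l⁻¹ * pulse N (fun _ => 1) l x = l⁻¹ := by
      intro x
      rw [pulse]
      split_ifs
      · left; field_simp
      · right; simp
    have key : RHOn p K (fun x => l⁻¹ * pulse N (fun _ => 1) l x) a b := by
      have hpos : ∀ x, 0 ≤ pulse N (fun _ => 1) l x := fun x => by linarith [h1 x]
      refine RHOn.of_affine hab hlin (fun x => mul_nonneg (by positivity) (hpos x)) ?_ ?_ ?_
      · have := (intervalIntegrable_rpow hm h1 ⟨_, hC⟩ 1 a b).const_mul l⁻¹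
        simpa using this
      · have := (intervalIntegrable_rpow hm h1 ⟨_, hC⟩ p a b).const_mul (l⁻¹ ^ p)
        refine this.congr fun x _ => ?_
        rw [Real.mul_rpow (by positivity) (hpos x)]
      · rw [intervalIntegral.integral_of_le hab.le]
        refine integral_nonpos fun x => ?_
        rcases hG x with h | h <;> simp only [h, Pi.zero_apply]
        · simp; linarith
        · linarith
    have := key.const_mul hl0 (fun x => mul_nonneg (by positivity) (by linarith [h1 x])) hab.le
    refine this.congr hab.le fun x _ => ?_
    field_simp

lemma IsCellular.integral_pulse {p K l c : ℝ} {m f : ℝ → ℝ} (hf : IsCellular p K l m f)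
    (hl : 0 < l) (hc : 0 < c) {N : ℕ} (hN : (N : ℝ) + 1 / 2 ≤ c / 2) (q : ℝ) :
    ∫ y in (-(1 / 2) : ℝ)..(1 / 2), pulse N f l (c * y) ^ q =
      c⁻¹ * ((2 * N + 1) * (l ^ q * m q) + (c - (2 * N + 1))) := by
  rw [intervalIntegral.integral_comp_mul_left (fun z => pulse N f l z ^ q) hc.ne']
  have e : (fun z => pulse N f l z ^ q) = fun z =>
      if z ∈ Ioc (-(N + 1 / 2 : ℝ)) (N + 1 / 2) then l ^ q * f z ^ q else 1 := by
    funext z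
    rw [pulse]
    split_ifs
    · exact Real.mul_rpow hl.le (by linarith [hf.one_le z])
    · exact Real.one_rpow q
  have i1 := fun a b => (intervalIntegrable_rpow hf.measurable hf.one_le hf.bdd q
    a b).const_mul (l ^ q)
  rw [e, show c * -(1 / 2) = -(c / 2) by ring, show c * (1 / 2) = c / 2 by ring,
    integral_ite_Ioc i1 (by positivity) hN, integral_cells (v := l ^ q * m q) i1 fun j => by
      rw [intervalIntegral.integral_const_mul, hf.moment]]
  rw [smul_eq_mul]
  ring

set_option maxHeartbeats 1000000 in
/-- One refinement: inside each unit cell put `1` near the boundary and many shrunken copies of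
`l * f` in the middle. -/
lemma IsCellular.refine_cell {p K l A B d τ : ℝ} {m f : ℝ → ℝ} (hf : IsCellular p K l m f)
    (hp : 0 < p) (hl : 1 < l) (hτ : 0 < τ) (hτ1 : τ < 1) (hA : 0 ≤ A) (hd : 0 < d)
    (hlin : ∀ t, 0 ≤ t → A * t - B ≤ K * t ^ p) (hone : 1 ≤ A - (B + d))
    (hinv : (l⁻¹) ^ p ≤ A * l⁻¹ - (B + d)) (hm : l ^ p * m p ≤ A * (l * m 1) - (B + d)) :
    ∃ g, IsCellular p K l (fun q => τ + (1 - τ) * (l ^ q * m q)) g := by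
  have hl0 : 0 < l := by linarith
  have hf0 : ∀ x, 0 ≤ f x := fun x => by linarith [hf.one_le x]
  obtain ⟨C, hC⟩ := hf.bdd
  have hC1 : 1 ≤ C := (hf.one_le 0).trans (hC 0)
  set D := (l * C) ^ p + A * (l * C) + |B + d| with hD
  have hD0 : 0 ≤ D := by positivity
  -- the affine defect of `l * f`
  set ζ : ℝ → ℝ := fun z => (l * f z) ^ p - A * (l * f z) + (B + d) with hζ
  have hζm : Measurable ζ := by have := hf.measurable; fun_prop
  have hζD : ∀ z, |ζ z| ≤ D := by
    intro z
    have h1 : 0 ≤ l * f z := mul_nonneg hl0.le (hf0 z)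
    have h2 : l * f z ≤ l * C := by gcongr; exact hC z
    have h3 : (l * f z) ^ p ≤ (l * C) ^ p := Real.rpow_le_rpow h1 h2 hp.le
    have h4 : 0 ≤ (l * f z) ^ p := Real.rpow_nonneg h1 p
    have h5 : A * (l * f z) ≤ A * (l * C) := by gcongr
    have h6 : 0 ≤ A * (l * f z) := mul_nonneg hA h1
    rw [abs_le]
    constructor <;> linarith [le_abs_self (B + d), neg_abs_le (B + d)]
  have hζi := fun a b => intervalIntegrable_of_bounded hζm hζD a b
  set v := l ^ p * m p - A * (l * m 1) + (B + d) with hv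
  have hv0 : v ≤ 0 := by linarith
  have hζcell : ∀ k : ℤ, ∫ z in (k - 1 / 2 : ℝ)..(k + 1 / 2), ζ z = v := by
    intro k
    have i1 := (intervalIntegrable_rpow hf.measurable hf.one_le hf.bdd p (k - 1 / 2 : ℝ)
      (k + 1 / 2)).const_mul (l ^ p)
    have i2 := (intervalIntegrable_rpow hf.measurable hf.one_le hf.bdd 1 (k - 1 / 2 : ℝ)
      (k + 1 / 2)).const_mul (A * l)
    have e : ζ = fun z => l ^ p * f z ^ p - A * l * f z ^ (1 : ℝ) + (B + d) := by
      funext z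
      rw [hζ]
      simp only [Real.mul_rpow hl0.le (hf0 z), Real.rpow_one]
      ring
    rw [e, intervalIntegral.integral_add (i1.sub i2) (by simp),
      intervalIntegral.integral_sub i1 i2, intervalIntegral.integral_const_mul,
      intervalIntegral.integral_const_mul, hf.moment, hf.moment, intervalIntegral.integral_const]
    simp only [smul_eq_mul]
    ring
  obtain ⟨N, hN⟩ := exists_nat_ge (8 * D / (d * τ))
  set c := (2 * N + 1) / (1 - τ) with hc
  have hτ' : 0 < 1 - τ := by linarith
  have hcτ : c * (1 - τ) = 2 * N + 1 := div_mul_cancel₀ _ hτ'.ne'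
  have hN0 : (0 : ℝ) ≤ N := N.cast_nonneg
  have hc0 : 0 < c := by positivity
  have hcN : (N : ℝ) + 1 / 2 < c / 2 := by nlinarith
  have hce : 4 * D / c ≤ d * τ / 2 := by
    rw [div_le_iff₀ hc0]
    have : 8 * D ≤ N * (d * τ) := by rwa [div_le_iff₀ (by positivity)] at hN
    nlinarith [mul_pos hd hτ]
  -- the truncated defect
  set Z : ℝ → ℝ := fun z => if z ∈ Ioc (-(N + 1 / 2 : ℝ)) (N + 1 / 2) then ζ z else 0 with hZ
  have hZm : Measurable Z := Measurable.ite measurableSet_Ioc hζm measurable_const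
  have hZD : ∀ z, |Z z| ≤ D := by
    intro z
    simp only [hZ]
    split_ifs
    · exact hζD z
    · simpa using hD0
  have hZi := fun a b => intervalIntegrable_of_bounded hZm hZD a b
  have hpart : ∀ {F : ℝ → ℝ} (_ : ∀ z, |F z| ≤ D) {a b : ℝ} (_ : a ≤ b) (_ : b ≤ a + 1),
      ∫ z in a..b, F z ≤ D := by
    intro F hF a b hab hb
    have h := intervalIntegral.norm_integral_le_of_norm_le_const (a := a) (b := b) (f := F)
      (C := D) (fun z _ => hF z)
    rw [abs_of_nonneg (by linarith)] at h
    calc ∫ z in a..b, F z ≤ D * (b - a) := (le_abs_self _).trans h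
      _ ≤ D := by nlinarith
  have hZint : ∀ a b, a ≤ b → ∫ z in a..b, Z z ≤ 2 * D := by
    intro a b hab
    refine integral_le_of_cells hZi (fun k => ?_)
      (fun k s t hs hst ht => hpart hZD hst (by linarith)) hab
    by_cases hk : k.natAbs ≤ N
    · rw [intervalIntegral.integral_congr_ae (g := ζ), hζcell]
      · exact hv0
      · refine Eventually.of_forall fun x hx => ?_
        rw [uIoc_of_le (by linarith)] at hx
        exact if_pos ((mem_Ioc_iff_natAbs_le hx).2 hk)
    · rw [intervalIntegral.integral_congr_ae (g := fun _ => 0)]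
      · simp
      · refine Eventually.of_forall fun x hx => ?_
        rw [uIoc_of_le (by linarith)] at hx
        exact if_neg fun h => hk ((mem_Ioc_iff_natAbs_le hx).1 h)
  have hZfull : ∫ z in (-(c / 2))..(c / 2), Z z ≤ 0 := by
    rw [hZ, integral_ite_Ioc hζi (by positivity) hcN.le, integral_cells hζi hζcell]
    nlinarith
  -- the refined function
  set G : ℝ → ℝ := fun y => pulse N f l (c * y) with hG
  have hGm : Measurable G := (measurable_pulse hf.measurable).comp (by fun_prop)
  have hG1 : ∀ y, 1 ≤ G y := fun y => one_le_pulse hl.le hf.one_le _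
  have hGC : ∀ y, G y ≤ l * C := fun y => pulse_le hl.le hf.one_le hC _
  have hGout : ∀ (_ : ℤ) (y : ℝ), 1 / 2 ≤ |y| → G y = 1 := by
    intro _ y hy
    refine if_neg fun h => ?_
    rcases le_abs.1 hy with h' | h'
    · nlinarith [h.2]
    · nlinarith [h.1]
  set g := tile fun _ => G with hg
  have hgm : Measurable g := measurable_tile fun _ => hGm
  have hg1 : ∀ x, 1 ≤ g x := fun x => hG1 _
  have hgC : ∀ x, g x ≤ l * C := fun x => hGC _
  have hgk : ∀ {k : ℤ} {x : ℝ}, x ∈ Ioc (k - 1 / 2 : ℝ) (k + 1 / 2) → g x = G (x - k) := by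
    intro k x hx
    exact tile_eq hGout (by rw [abs_le]; constructor <;> linarith [hx.1, hx.2])
  refine ⟨g, hgm, hg1, ⟨_, hgC⟩, fun k q => ?_, fun N' a b hab => ?_⟩
  · rw [intervalIntegral.integral_congr_ae (g := fun x => G (x - k) ^ q)]
    · rw [intervalIntegral.integral_comp_sub_right (fun y => G y ^ q), hG,
        show (k - 1 / 2 - k : ℝ) = -(1 / 2) by ring, show (k + 1 / 2 - k : ℝ) = 1 / 2 by ring,
        hf.integral_pulse hl0 hc0 hcN.le, ← hcτ]
      field_simp
      ring
    · refine Eventually.of_forall fun x hx => ?_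
      rw [uIoc_of_le (by linarith)] at hx
      simp only [hgk hx]
  · set P : ℝ → ℝ := fun x => l⁻¹ * pulse N' g l x with hP
    have hpm : Measurable (pulse N' g l) := measurable_pulse hgm
    have hp1 := fun x => one_le_pulse (N := N') hl.le hg1 x
    have hpC := fun x => pulse_le (N := N') hl.le hg1 hgC x
    have hp0 : ∀ x, 0 ≤ pulse N' g l x := fun x => by linarith [hp1 x]
    have hP0 : ∀ x, 0 ≤ P x := fun x => mul_nonneg (by positivity) (hp0 x)
    have hPi1 : ∀ a b, IntervalIntegrable P volume a b := fun a b => by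
      simpa using (intervalIntegrable_rpow hpm hp1 ⟨_, hpC⟩ 1 a b).const_mul l⁻¹
    have hPip : ∀ a b, IntervalIntegrable (fun x => P x ^ p) volume a b := fun a b => by
      refine ((intervalIntegrable_rpow hpm hp1 ⟨_, hpC⟩ p a b).const_mul (l⁻¹ ^ p)).congr
        fun x _ => ?_
      rw [hP, Real.mul_rpow (by positivity) (hp0 x)]
    suffices key : RHOn p K P a b by
      refine (key.const_mul hl0 hP0 hab.le).congr hab.le fun x _ => ?_
      simp only [hP]
      field_simp
    have hPin : ∀ {k : ℤ} {x : ℝ}, k.natAbs ≤ N' → x ∈ Ioc (k - 1 / 2 : ℝ) (k + 1 / 2) →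
        P x = G (x - k) := by
      intro k x hk hx
      simp only [hP]
      rw [pulse, if_pos ((mem_Ioc_iff_natAbs_le hx).2 hk), hgk hx, inv_mul_cancel_left₀ hl0.ne']
    have hPout : ∀ {k : ℤ} {x : ℝ}, ¬ k.natAbs ≤ N' → x ∈ Ioc (k - 1 / 2 : ℝ) (k + 1 / 2) →
        P x = l⁻¹ := by
      intro k x hk hx
      simp only [hP]
      rw [pulse, if_neg fun h => hk ((mem_Ioc_iff_natAbs_le hx).1 h), mul_one]
    set ψ : ℝ → ℝ := fun x => P x ^ p - A * P x + (B + d) with hψ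
    have hψi : ∀ a b, IntervalIntegrable ψ volume a b := fun a b =>
      ((hPip a b).sub ((hPi1 a b).const_mul A)).add (by simp)
    have hψ1 : ∀ {x}, P x = 1 → ψ x ≤ 0 := by
      intro x hx
      simp only [hψ, hx, Real.one_rpow]
      linarith
    have hψl : ∀ {x}, P x = l⁻¹ → ψ x ≤ 0 := by
      intro x hx
      simp only [hψ, hx]
      linarith
    have hψZ : ∀ {k : ℤ} {x : ℝ}, k.natAbs ≤ N' → x ∈ Ioc (k - 1 / 2 : ℝ) (k + 1 / 2) →
        ψ x ≤ Z (c * (x - k)) := by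
      intro k x hk hx
      have h := hPin hk hx
      simp only [hG, pulse] at h
      simp only [hZ]
      split_ifs at h ⊢
      · simp only [hψ, h, hζ]; exact le_rfl
      · exact hψ1 h
    have hcell : ∀ (k : ℤ) (s t : ℝ), (k - 1 / 2 : ℝ) ≤ s → s ≤ t → t ≤ k + 1 / 2 →
        ∫ x in s..t, ψ x ≤ max 0 (c⁻¹ * ∫ z in (c * (s - k))..(c * (t - k)), Z z) := by
      intro k s t hs hst ht
      by_cases hk : k.natAbs ≤ N'
      · refine le_max_of_le_right ?_
        have e : c⁻¹ * ∫ z in (c * (s - k))..(c * (t - k)), Z z =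
            ∫ x in s..t, Z (c * (x - k)) := by
          rw [intervalIntegral.integral_comp_sub_right (fun y => Z (c * y)),
            intervalIntegral.integral_comp_mul_left (fun z => Z z) hc0.ne', smul_eq_mul]
        rw [e]
        have hi : IntervalIntegrable (fun x => Z (c * (x - k))) volume s t :=
          intervalIntegrable_of_bounded (hZm.comp (by fun_prop)) (fun x => hZD _) s t
        refine intervalIntegral.integral_mono_on_of_le_Ioo hst (hψi s t) hi fun x hx => ?_
        exact hψZ hk ⟨by linarith [hx.1], by linarith [hx.2]⟩
      · refine le_max_of_le_left ?_
        rw [intervalIntegral.integral_of_le hst]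
        refine setIntegral_nonpos measurableSet_Ioc fun x hx => ?_
        exact hψl (hPout hk ⟨by linarith [hx.1], by linarith [hx.2]⟩)
    by_cases hlen : τ / 2 ≤ b - a
    · -- long intervals: the averaging error is absorbed by the slack `d`
      refine RHOn.of_affine hab hlin hP0 (hPi1 a b) (hPip a b) ?_
      have h1 : ∫ x in a..b, ψ x ≤ 2 * (c⁻¹ * (2 * D)) := by
        refine integral_le_of_cells hψi (fun k => ?_) (fun k s t hs hst ht => ?_) hab.le
        · refine (hcell k _ _ le_rfl (by linarith) le_rfl).trans (max_le le_rfl ?_)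
          rw [show c * (k - 1 / 2 - k) = -(c / 2) by ring, show c * (k + 1 / 2 - k) = c / 2 by ring]
          exact mul_nonpos_of_nonneg_of_nonpos (by positivity) hZfull
        · refine (hcell k s t hs hst ht).trans (max_le (by positivity) ?_)
          gcongr
          exact hZint _ _ (by gcongr)
      have h2 : ∫ x in a..b, (P x ^ p - A * P x + B) = (∫ x in a..b, ψ x) - (b - a) * d := by
        have : (fun x => P x ^ p - A * P x + B) = fun x => ψ x - d := by
          funext x; simp only [hψ]; ring
        rw [this, intervalIntegral.integral_sub (hψi a b) (by simp)]
        simp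
      have h3 : 2 * (c⁻¹ * (2 * D)) = 4 * D / c := by field_simp; ring
      rw [h2]
      nlinarith
    · push Not at hlen
      by_cases hmeet : ∃ k : ℤ, k.natAbs ≤ N' ∧ ∃ x ∈ Ioc a b, |x - k| ≤ (1 - τ) / 2
      · -- short intervals near the middle of a cell
        obtain ⟨k, hk, x, hx, hxk⟩ := hmeet
        rw [abs_le] at hxk
        have hsub : ∀ y ∈ Ioc a b, pulse N f l (c * y - c * k) = P y := by
          intro y hy
          rw [hPin hk ⟨by linarith [hx.1, hx.2, hy.1, hy.2], by linarith [hx.1, hx.2, hy.1, hy.2]⟩]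
          simp only [hG]
          congr 1
          ring
        refine RHOn.congr ?_ hab.le hsub
        exact RHOn.comp_mul_sub hc0 (hf.rh N _ _ (by gcongr))
      · -- short intervals on which the function takes the values `1` and `l⁻¹` only
        push Not at hmeet
        refine RHOn.of_affine hab hlin hP0 (hPi1 a b) (hPip a b) ?_
        rw [intervalIntegral.integral_of_le hab.le]
        refine setIntegral_nonpos measurableSet_Ioc fun x hx => ?_
        suffices h : ψ x ≤ 0 by simp only [hψ] at h; linarith
        have hxk : x ∈ Ioc ((⌈x - 1 / 2⌉ : ℤ) - 1 / 2 : ℝ) ((⌈x - 1 / 2⌉ : ℤ) + 1 / 2) :=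
          ⟨by linarith [Int.ceil_lt_add_one (x - 1 / 2)], by linarith [Int.le_ceil (x - 1 / 2)]⟩
        by_cases hk : (⌈x - 1 / 2⌉).natAbs ≤ N'
        · refine hψ1 ((hPin hk hxk).trans (if_neg fun h => ?_))
          have h4 := hmeet _ hk x hx
          rcases lt_abs.1 h4 with h' | h'
          · nlinarith [h.2]
          · nlinarith [h.1]
        · exact hψl (hPout hk hxk)

/-- The moments produced by `n` refinements of the constant function `1`. -/
def cellMoment (τ l : ℝ) : ℕ → ℝ → ℝ
  | 0, _ => 1
  | n + 1, q => τ + (1 - τ) * (l ^ q * cellMoment τ l n q)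

lemma cellMoment_pos {τ l : ℝ} (hτ : 0 < τ) (hτ1 : τ < 1) (hl : 0 < l) (n : ℕ) (q : ℝ) :
    0 < cellMoment τ l n q := by
  induction n with
  | zero => exact one_pos
  | succ n ih =>
    have h1 : 0 < 1 - τ := by linarith
    have h2 := Real.rpow_pos_of_pos hl q
    rw [cellMoment]
    positivity

lemma exists_isCellular {p K l A B d τ μ : ℝ}
    (hp : 1 < p) (hl : 1 < l) (hτ : 0 < τ) (hτ1 : τ < 1) (hA : 0 ≤ A) (hd : 0 < d)
    (hlin : ∀ t, 0 ≤ t → A * t - B ≤ K * t ^ p) (hone : 1 ≤ A - (B + d))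
    (hinv : (l⁻¹) ^ p ≤ A * l⁻¹ - (B + d)) (hμ : ∀ n, cellMoment τ l n 1 ≤ μ)
    (hstep : A * μ * (l ^ p - l) ≤ (B + d) * (l ^ p - 1)) (n : ℕ) :
    ∃ f, IsCellular p K l (cellMoment τ l n) f := by
  have hl0 : 0 < l := by linarith
  have hlp : l ≤ l ^ p := Real.self_le_rpow_of_one_le hl.le hp.le
  have hstep' : ∀ n, cellMoment τ l n p ≤ A * cellMoment τ l n 1 - (B + d) →
      l ^ p * cellMoment τ l n p ≤ A * (l * cellMoment τ l n 1) - (B + d) := by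
    intro n h
    have h1 := mul_le_mul_of_nonneg_left h (Real.rpow_nonneg hl0.le p)
    have h2 : A * cellMoment τ l n 1 * (l ^ p - l) ≤ A * μ * (l ^ p - l) := by
      have : 0 ≤ l ^ p - l := by linarith
      gcongr
      exact hμ n
    linarith
  have hM : ∀ n, cellMoment τ l n p ≤ A * cellMoment τ l n 1 - (B + d) := by
    intro n
    induction n with
    | zero => simpa [cellMoment] using hone
    | succ n ih =>
      have h1 := mul_le_mul_of_nonneg_left (hstep' n ih) (show 0 ≤ 1 - τ by linarith)
      simp only [cellMoment, Real.rpow_one]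
      nlinarith
  induction n with
  | zero => exact ⟨_, IsCellular.of_one hl hlin (by linarith) (by linarith)⟩
  | succ n ih =>
    obtain ⟨f, hf⟩ := ih
    exact hf.refine_cell (by linarith) hl hτ hτ1 hA hd hlin hone hinv (hstep' n (hM n))

lemma cellMoment_one_le {τ σ : ℝ} (hτ : 0 < τ) (hτ1 : τ < 1) (hσ : 0 < σ) (hσ1 : σ < 1) (n : ℕ) :
    cellMoment τ (1 + σ * τ) n 1 ≤ 1 / (1 - σ) := by
  have h1 : 0 < 1 - σ := by linarith
  induction n with
  | zero => rw [cellMoment, le_div_iff₀ h1]; linarith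
  | succ n ih =>
    rw [le_div_iff₀ h1] at ih ⊢
    rw [cellMoment, Real.rpow_one]
    have h2 : 0 ≤ (1 - τ) * (1 + σ * τ) := mul_nonneg (by linarith) (by positivity)
    nlinarith [mul_le_mul_of_nonneg_left ih h2, mul_pos hσ (mul_pos hτ hτ)]

lemma eventually_lt_cellMoment {τ σ q T : ℝ} (hτ : 0 < τ) (hτ1 : τ < 1) (hσ : 0 < σ)
    (hq : 1 ≤ q) (hqσ : q * σ < 1) (hT : 0 < T) (h : 1 - q * (σ * (1 - τ)) < 1 / T) :
    ∀ᶠ n in atTop, T < cellMoment τ (1 + σ * τ) n q := by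
  set D := 1 - q * (σ * (1 - τ)) with hD
  have hτ' : 0 < 1 - τ := by linarith
  have hqσ0 : 0 < q * σ := by positivity
  have hD0 : 0 < D := by nlinarith
  have hD1 : D < 1 := by nlinarith [mul_pos hqσ0 hτ']
  have hr0 : 0 ≤ 1 - τ * D := by nlinarith
  have hr1 : 1 - τ * D < 1 := by nlinarith
  have hlow : ∀ n, (1 - (1 - τ * D) ^ n) / D ≤ cellMoment τ (1 + σ * τ) n q := by
    intro n
    induction n with
    | zero => simp [cellMoment]
    | succ n ih =>
      have hb : 1 + q * (σ * τ) ≤ (1 + σ * τ) ^ q :=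
        one_add_mul_self_le_rpow_one_add (by nlinarith) hq
      have hm := (cellMoment_pos hτ hτ1 (show 0 < 1 + σ * τ by positivity) n q).le
      have h1 : (1 - τ * D) ≤ (1 - τ) * (1 + σ * τ) ^ q := by
        have := mul_le_mul_of_nonneg_left hb hτ'.le
        rw [hD]
        linarith
      have h2 := mul_le_mul_of_nonneg_right h1 hm
      have h3 := mul_le_mul_of_nonneg_left ih hr0
      have h4 : (1 - (1 - τ * D) ^ (n + 1)) / D = τ + (1 - τ * D) * ((1 - (1 - τ * D) ^ n) / D) := by
        field_simp
        ring
      rw [cellMoment, h4]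
      linarith
  have hlim : Tendsto (fun n : ℕ => (1 - (1 - τ * D) ^ n) / D) atTop (nhds ((1 - 0) / D)) :=
    ((tendsto_pow_atTop_nhds_zero_of_lt_one hr0 hr1).const_sub 1).div_const D
  have hTD : T < (1 - 0) / D := by
    rw [sub_zero, lt_div_iff₀ hD0]
    rwa [lt_div_iff₀ hT, mul_comm] at h
  filter_upwards [hlim.eventually_const_lt hTD] with n hn
  exact hn.trans_le (hlow n)

lemma exists_isCellular_moment {p K s : ℝ} (hp : 1 < p) (hK : 1 < K) (hs : 0 < s)
    (hps : p * s < 1) (hKs : K * (1 - p * s) = (1 - s) ^ p) {T₁ T₂ : ℝ} (hT₁ : 0 < T₁)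
    (hT₁s : T₁ * (1 - p * s) < 1) (hT₂ : 0 < T₂) :
    ∃ l m f, 1 < l ∧ IsCellular p K l m f ∧ T₁ < m p ∧ T₂ < m (1 / s) ∧ 0 < m 1 ∧
      m 1 ≤ 1 / (1 - s) := by
  have hs1 : s < 1 := by nlinarith
  obtain ⟨σ, hσ0, hσs, hσ1, hσ2⟩ : ∃ σ, 0 < σ ∧ σ < s ∧ 1 - p * σ < 1 / T₁ ∧
      1 - 1 / s * σ < 1 / T₂ := by
    have h0 : ∀ᶠ σ in nhdsWithin s (Iio s), 0 < σ :=
      nhdsWithin_le_nhds (eventually_gt_nhds hs)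
    have hlt : ∀ᶠ σ in nhdsWithin s (Iio s), σ < s := self_mem_nhdsWithin
    have h1 : ∀ᶠ σ in nhdsWithin s (Iio s), 1 - p * σ < 1 / T₁ := by
      refine nhdsWithin_le_nhds (ContinuousAt.eventually_lt (by fun_prop) (by fun_prop) ?_)
      rw [lt_div_iff₀ hT₁]
      linarith
    have h2 : ∀ᶠ σ in nhdsWithin s (Iio s), 1 - 1 / s * σ < 1 / T₂ := by
      refine nhdsWithin_le_nhds (ContinuousAt.eventually_lt (by fun_prop) (by fun_prop) ?_)
      rw [div_mul_cancel₀ _ hs.ne', sub_self]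
      positivity
    obtain ⟨σ, a, b, c, d⟩ := (h0.and (hlt.and (h1.and h2))).exists
    exact ⟨σ, a, b, c, d⟩
  have hσlt : σ < 1 := by linarith
  have h1σ : 0 < 1 - σ := by linarith
  have hpσ : p * σ < 1 := by nlinarith
  have hsσ : 1 / s * σ < 1 := by rwa [one_div, inv_mul_lt_iff₀ hs, mul_one]
  have hpow : 0 < (1 - σ) ^ p := Real.rpow_pos_of_pos h1σ p
  have hconv : (1 - σ) ^ p < K * (1 - p * σ) := by
    have ht0 : 0 < σ / s := by positivity
    have ht1 : σ / s < 1 := (div_lt_one hs).2 hσs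
    have h := (convexOn_rpow hp.le).2 (show (1 : ℝ) ∈ Ici 0 by simp)
      (show 1 - s ∈ Ici 0 by simp only [mem_Ici]; linarith)
      (show 0 ≤ 1 - σ / s by linarith) ht0.le (by ring)
    simp only [smul_eq_mul, Real.one_rpow, ← hKs] at h
    have e1 : (1 - σ / s) * 1 + σ / s * (1 - s) = 1 - σ := by field_simp; ring
    have e2 : K * (1 - p * σ) = (1 - σ / s) * K + σ / s * (K * (1 - p * s)) := by field_simp; ring
    rw [e1] at h
    rw [e2]
    nlinarith
  set κ := K / (1 - σ) ^ p with hκ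
  have hκ0 : 0 < κ := by positivity
  have hκK : κ * (1 - σ) ^ p = K := div_mul_cancel₀ _ hpow.ne'
  have hκ1 : 1 < κ * (1 - p * σ) := by
    rw [hκ, div_mul_eq_mul_div, one_lt_div hpow]
    exact hconv
  obtain ⟨d, hd⟩ : ∃ d, d = (κ * (1 - p * σ) - 1) / 2 := ⟨_, rfl⟩
  have hd0 : 0 < d := by rw [hd]; linarith
  have hlin : ∀ t, 0 ≤ t → κ * p * (1 - σ) * t - κ * (p - 1) ≤ K * t ^ p := by
    intro t ht
    have h := one_add_mul_self_le_rpow_one_add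
      (show -1 ≤ (1 - σ) * t - 1 by nlinarith [mul_nonneg h1σ.le ht]) hp.le
    rw [add_sub_cancel, Real.mul_rpow h1σ.le ht] at h
    have := mul_le_mul_of_nonneg_left h hκ0.le
    rw [← mul_assoc κ, hκK] at this
    linarith
  have hone : 1 + d ≤ κ * p * (1 - σ) - (κ * (p - 1) + d) := by rw [hd]; linarith
  have hF : ∀ᶠ l in nhdsWithin (1 : ℝ) (Ioi 1),
      κ * p * (l ^ p - l) ≤ (κ * (p - 1) + d) * (l ^ p - 1) := by
    have hder : HasDerivAt
        (fun l : ℝ => (κ * (p - 1) + d) * (l ^ p - 1) - κ * p * (l ^ p - l))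
        ((κ * (p - 1) + d) * (p * 1 ^ (p - 1)) - κ * p * (p * 1 ^ (p - 1) - 1)) 1 := by
      have h := Real.hasDerivAt_rpow_const (x := 1) (p := p) (Or.inl one_ne_zero)
      exact ((h.sub_const 1).const_mul _).sub ((h.sub (hasDerivAt_id 1)).const_mul _)
    have hpos : 0 < (κ * (p - 1) + d) * (p * 1 ^ (p - 1)) - κ * p * (p * 1 ^ (p - 1) - 1) := by
      rw [Real.one_rpow]
      nlinarith
    have hsl := (hasDerivAt_iff_tendsto_slope.1 hder).eventually_const_lt hpos
    have hle : nhdsWithin (1 : ℝ) (Ioi 1) ≤ nhdsWithin 1 {1}ᶜ :=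
      nhdsWithin_mono _ fun x hx => (ne_of_gt hx : x ≠ 1)
    filter_upwards [hle hsl, self_mem_nhdsWithin] with l hl hl1
    rw [slope_def_field, Real.one_rpow] at hl
    have hl1' : 0 < l - 1 := sub_pos.2 hl1
    have := (div_pos_iff_of_pos_right hl1').1 hl
    linarith
  have hinv : ∀ᶠ l in nhdsWithin (1 : ℝ) (Ioi 1),
      (l⁻¹) ^ p < κ * p * (1 - σ) * l⁻¹ - (κ * (p - 1) + d) := by
    have hc : ContinuousAt (fun l : ℝ => l⁻¹) 1 := continuousAt_inv₀ one_ne_zero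
    refine nhdsWithin_le_nhds (ContinuousAt.eventually_lt
      (hc.rpow_const (Or.inr (by linarith))) ((hc.const_mul _).sub continuousAt_const) ?_)
    simp only [inv_one, Real.one_rpow]
    linarith
  have hev : ∀ {q T : ℝ}, 1 - q * σ < 1 / T → ∀ᶠ l in nhdsWithin (1 : ℝ) (Ioi 1),
      1 - q * (σ * (1 - (l - 1) / σ)) < 1 / T := by
    intro q T h
    refine nhdsWithin_le_nhds (ContinuousAt.eventually_lt (by fun_prop) (by fun_prop) ?_)
    simpa using h
  have hsmall : ∀ᶠ l in nhdsWithin (1 : ℝ) (Ioi 1), (l - 1) / σ < 1 := by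
    refine nhdsWithin_le_nhds (ContinuousAt.eventually_lt (by fun_prop) (by fun_prop) ?_)
    simp
  have hgt : ∀ᶠ l in nhdsWithin (1 : ℝ) (Ioi 1), 1 < l := self_mem_nhdsWithin
  obtain ⟨l, hl1, hlF, hlinv, hl₁, hl₂, hlτ⟩ := (hgt.and
    (hF.and (hinv.and ((hev hσ1).and ((hev hσ2).and hsmall))))).exists
  set τ := (l - 1) / σ with hτ
  have hτ0 : 0 < τ := div_pos (by linarith) hσ0
  have hlτ' : 1 + σ * τ = l := by rw [hτ]; field_simp; ring
  have hq : 1 ≤ 1 / s := by rw [le_div_iff₀ hs]; linarith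
  obtain ⟨n, hn₁, hn₂⟩ := ((eventually_lt_cellMoment hτ0 hlτ hσ0 hp.le hpσ hT₁ hl₁).and
    (eventually_lt_cellMoment hτ0 hlτ hσ0 hq hsσ hT₂ hl₂)).exists
  have hμ := cellMoment_one_le hτ0 hlτ hσ0 hσlt
  rw [hlτ'] at hn₁ hn₂ hμ
  obtain ⟨f, hf⟩ := exists_isCellular hp hl1 hτ0 hlτ (by positivity) hd0 hlin (by linarith)
    hlinv.le hμ (by
      rw [show κ * p * (1 - σ) * (1 / (1 - σ)) = κ * p by field_simp]
      exact hlF) n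
  refine ⟨l, _, f, hl1, hf, hn₁, hn₂, cellMoment_pos hτ0 hlτ (by linarith) n 1, (hμ n).trans ?_⟩
  exact one_div_le_one_div_of_le (by linarith) (by linarith)

lemma exists_isCellular_sharp {p Q s c R : ℝ} (hp : 1 < p) (hQ : 1 < Q) (hs : 0 < s)
    (hps : p * s < 1) (hKs : Q ^ p * (1 - p * s) = (1 - s) ^ p) (hc : 0 < c) (hc1 : c < 1)
    (hR : 0 < R) :
    ∃ l m f, 1 < l ∧ IsCellular p (Q ^ p) l m f ∧ c * Q < m p ^ (1 / p) * (m 1)⁻¹ ∧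
      R < m (1 / s) ^ (1 / (1 / s)) * (m 1)⁻¹ := by
  have hs1 : 0 < 1 - s := by nlinarith
  have hp0 : 0 < p := by linarith
  have hQ0 : 0 < Q := by linarith
  obtain ⟨l, m, f, hl, hf, h1, h2, hm0, hm1⟩ := exists_isCellular_moment hp
    (Real.one_lt_rpow hQ hp0) hs hps hKs (T₁ := (c * Q / (1 - s)) ^ p)
    (T₂ := (R / (1 - s)) ^ (1 / s)) (by positivity) (by
      rw [Real.div_rpow (by positivity) hs1.le, Real.mul_rpow hc.le hQ0.le, div_mul_eq_mul_div,
        mul_assoc, hKs, mul_div_assoc, div_self (by positivity), mul_one]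
      exact Real.rpow_lt_one hc.le hc1 hp0) (by positivity)
  have key : ∀ {q T : ℝ}, 0 < q → 0 < T → (T / (1 - s)) ^ q < m q →
      T < m q ^ (1 / q) * (m 1)⁻¹ := by
    intro q T hq hT h
    have h3 : T / (1 - s) < m q ^ (1 / q) := by
      have := Real.rpow_lt_rpow (by positivity) h (show 0 < 1 / q by positivity)
      rwa [← Real.rpow_mul (by positivity), mul_one_div_cancel hq.ne', Real.rpow_one] at this
    rw [← div_eq_mul_inv, lt_div_iff₀ hm0]
    calc T * m 1 ≤ T * (1 / (1 - s)) := by gcongr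
      _ = T / (1 - s) := by ring
      _ < _ := h3
  exact ⟨l, m, f, hl, hf, key hp0 (by positivity) h1, key (by positivity) hR h2⟩

lemma intAvg_eq {a b : ℝ} (hab : a < b) (F : ℝ → ℝ) :
    intAvg a b F = (∫ x in a..b, F x) / (b - a) := by
  rw [intAvg, setAverage_eq, intervalIntegral.integral_of_le hab.le, integral_Ioc_eq_integral_Ioo,
    measureReal_def, Real.volume_Ioo, ENNReal.toReal_ofReal (by linarith), smul_eq_mul,
    div_eq_inv_mul]

lemma IsCellular.moment_pos {p K l : ℝ} {m f : ℝ → ℝ} (hf : IsCellular p K l m f) (q : ℝ) :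
    0 < m q := by
  rw [← hf.moment 0 q]
  refine intervalIntegral.intervalIntegral_pos_of_pos
    (intervalIntegrable_rpow hf.measurable hf.one_le hf.bdd q _ _) (fun x => ?_) (by linarith)
  exact Real.rpow_pos_of_pos (by linarith [hf.one_le x]) q

/-- A weight that carries, near each integer `k`, one shrunken cell of `l k * f k`. -/
lemma exists_weight_of_isCellular {p K : ℝ} (hp : 0 < p) (hK : 1 < K) {l : ℕ → ℝ} {m f : ℕ → ℝ → ℝ}
    (hl : ∀ j, 1 < l j) (hf : ∀ j, IsCellular p K (l j) (m j) (f j)) :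
    ∃ w : ℝ → ℝ, Measurable w ∧ (∀ x, 1 ≤ w x) ∧
      (∀ q a b : ℝ, IntervalIntegrable (fun x => w x ^ q) volume a b) ∧
      (∀ a b, a < b → RHOn p K w a b) ∧
      ∀ j, ∃ a b, a < b ∧ ∀ q : ℝ, 0 < q → RHChar w q a b = m j q ^ (1 / q) * (m j 1)⁻¹ := by
  have hl0 : ∀ j, 0 < l j := fun j => by linarith [hl j]
  set η := (K - 1) / 9 with hη
  have hη0 : 0 < η := by rw [hη]; linarith
  have hmass : ∀ j, 0 < l j ^ p * m j p := fun j =>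
    mul_pos (Real.rpow_pos_of_pos (hl0 j) p) ((hf j).moment_pos p)
  -- `r j` is the width of the `j`-th cell
  obtain ⟨r, hr0, hr1, hrη⟩ : ∃ r : ℕ → ℝ, (∀ j, 0 < r j) ∧ (∀ j, r j ≤ 1 / 2) ∧
      ∀ j, r j * (l j ^ p * m j p) ≤ η := by
    refine ⟨fun j => min (1 / 2) (η / (l j ^ p * m j p)), fun j => ?_, fun j => min_le_left _ _,
      fun j => ?_⟩
    · exact lt_min (by norm_num) (div_pos hη0 (hmass j))
    · rw [← le_div_iff₀ (hmass j)]
      exact min_le_right _ _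
  set F : ℤ → ℝ → ℝ := fun k y => pulse 0 (f k.natAbs) (l k.natAbs) ((r k.natAbs)⁻¹ * y) with hF
  have hFm : ∀ k, Measurable (F k) := fun k =>
    (measurable_pulse (hf _).measurable).comp (by fun_prop)
  have hF1 : ∀ k y, 1 ≤ F k y := fun k y => one_le_pulse (hl _).le (hf _).one_le _
  have hFout : ∀ k y, r k.natAbs / 2 < |y| → F k y = 1 := by
    intro k y hy
    refine if_neg fun h => ?_
    have h0 := hr0 k.natAbs
    rw [CharP.cast_eq_zero, zero_add, mem_Ioc, inv_mul_le_iff₀ h0, ← div_eq_inv_mul,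
      lt_div_iff₀ h0] at h
    rcases lt_abs.1 hy with h' | h' <;> linarith [h.1, h.2]
  have hFcell : ∀ k y, 1 / 2 ≤ |y| → F k y = 1 := fun k y hy =>
    hFout k y (by linarith [hr1 k.natAbs])
  set w := tile F with hw
  have hwm : Measurable w := measurable_tile hFm
  have hw1 : ∀ x, 1 ≤ w x := fun x => hF1 _ _
  have hwk : ∀ {k : ℤ} {x : ℝ}, |x - k| ≤ 1 / 2 → w x = F k (x - k) := fun h =>
    tile_eq hFcell h
  have hwb : ∀ a b : ℝ, ∃ C, ∀ x ∈ Ioc a b, w x ≤ C := by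
    intro a b
    choose C hC using fun j => (hf j).bdd
    have hC1 : ∀ j, 1 ≤ C j := fun j => ((hf j).one_le 0).trans (hC j 0)
    refine ⟨∑ k ∈ Finset.Icc ⌊a + 1 / 2⌋ ⌊b + 1 / 2⌋, l k.natAbs * C k.natAbs, fun x hx => ?_⟩
    have hmem : ⌊x + 1 / 2⌋ ∈ Finset.Icc ⌊a + 1 / 2⌋ ⌊b + 1 / 2⌋ :=
      Finset.mem_Icc.2 ⟨Int.floor_le_floor (by linarith [hx.1]),
        Int.floor_le_floor (by linarith [hx.2])⟩
    refine le_trans ?_ (Finset.single_le_sum (f := fun k : ℤ => l k.natAbs * C k.natAbs)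
      (fun k _ => mul_nonneg (hl0 _).le (by linarith [hC1 k.natAbs])) hmem)
    exact pulse_le (hl _).le (hf _).one_le (hC _) _
  have hwi : ∀ q a b : ℝ, IntervalIntegrable (fun x => w x ^ q) volume a b := by
    intro q a b
    obtain ⟨C, hC⟩ := hwb (min a b) (max a b)
    have hb := intervalIntegrable_rpow (f := fun x => min (w x) (max C 1)) (by fun_prop)
      (fun x => le_min (hw1 x) (le_max_right _ _)) ⟨_, fun x => min_le_right _ _⟩ q a b
    refine hb.congr fun x hx => ?_
    have := min_eq_left ((hC x hx).trans (le_max_left C 1))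
    simp only [this]
  have hwi1 : ∀ a b, IntervalIntegrable w volume a b := fun a b => by simpa using hwi 1 a b
  have hcellint : ∀ (k : ℤ) (q : ℝ), ∫ x in (k - 1 / 2 : ℝ)..(k + 1 / 2), w x ^ q =
      r k.natAbs * (l k.natAbs ^ q * m k.natAbs q) + (1 - r k.natAbs) := by
    intro k q
    have h0 := hr0 k.natAbs
    rw [intervalIntegral.integral_congr (g := fun x => F k (x - k) ^ q)]
    · rw [intervalIntegral.integral_comp_sub_right (fun y => F k y ^ q), hF,
        show (k - 1 / 2 - k : ℝ) = -(1 / 2) by ring, show (k + 1 / 2 - k : ℝ) = 1 / 2 by ring,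
        (hf k.natAbs).integral_pulse (hl0 _) (inv_pos.2 h0) (N := 0) ?_]
      · rw [inv_inv]
        simp
        field_simp
      · have := (one_le_inv₀ h0).2 (by linarith [hr1 k.natAbs])
        simp
        linarith
    · intro x hx
      rw [uIcc_of_le (by linarith)] at hx
      simp only [hwk (show |x - k| ≤ 1 / 2 by rw [abs_le]; constructor <;> linarith [hx.1, hx.2])]
  refine ⟨w, hwm, hw1, hwi, fun a b hab => ?_, fun j => ?_⟩
  · by_cases hlen : 1 / 4 ≤ b - a
    · have hw1p : ∀ x, 1 ≤ w x ^ p := fun x => Real.one_le_rpow (hw1 x) hp.le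
      have hint : ∀ a b, IntervalIntegrable (fun x => w x ^ p - (1 + η)) volume a b := fun a b =>
        (hwi p a b).sub (by simp)
      have hcellp : ∀ k : ℤ, ∫ x in (k - 1 / 2 : ℝ)..(k + 1 / 2), w x ^ p ≤ 1 + η := fun k => by
        rw [hcellint]
        linarith [hrη k.natAbs, hr0 k.natAbs]
      have key := integral_le_of_cells (h := fun x => w x ^ p - (1 + η)) (e := η) hint
        (fun k => by
          rw [intervalIntegral.integral_sub (hwi p _ _) (by simp), intervalIntegral.integral_const,
            smul_eq_mul]
          linarith [hcellp k])
        (fun k c d hc hcd hd => by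
          have h1 : ∫ x in c..d, (w x ^ p - (1 + η)) ≤ ∫ x in c..d, (w x ^ p - 1) :=
            intervalIntegral.integral_mono_on hcd (hint _ _) ((hwi p _ _).sub (by simp))
              fun x _ => by linarith
          have h2 : ∫ x in c..d, (w x ^ p - 1) ≤
              ∫ x in (k - 1 / 2 : ℝ)..(k + 1 / 2), (w x ^ p - 1) :=
            intervalIntegral.integral_mono_interval hc hcd hd
              (Eventually.of_forall fun x => sub_nonneg.2 (hw1p x)) ((hwi p _ _).sub (by simp))
          rw [intervalIntegral.integral_sub (hwi p _ _) (by simp) (a := (k - 1 / 2 : ℝ)),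
            intervalIntegral.integral_const, smul_eq_mul] at h2
          linarith [hcellp k]) hab.le
      rw [intervalIntegral.integral_sub (hwi p _ _) (by simp), intervalIntegral.integral_const,
        smul_eq_mul] at key
      have hba : 0 < b - a := sub_pos.2 hab
      have hU : 1 ≤ (∫ x in a..b, w x) / (b - a) := by
        rw [le_div_iff₀ hba]
        have := intervalIntegral.integral_mono_on hab.le (f := fun _ => (1 : ℝ)) (by simp)
          (hwi1 a b) fun x _ => hw1 x
        simpa using this
      have hV : (∫ x in a..b, w x ^ p) / (b - a) ≤ K := by
        rw [div_le_iff₀ hba, show K = 1 + 9 * η by rw [hη]; ring]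
        nlinarith
      exact hV.trans (le_mul_of_one_le_right (by linarith) (Real.one_le_rpow hU hp.le))
    · push Not at hlen
      by_cases hmeet : ∃ k : ℤ, ∃ x ∈ Ioc a b, |x - k| ≤ r k.natAbs / 2
      · obtain ⟨k, x, hx, hxk⟩ := hmeet
        have hr := hr1 k.natAbs
        rw [abs_le] at hxk
        have hsub : ∀ y ∈ Ioc a b, pulse 0 (f k.natAbs) (l k.natAbs)
            ((r k.natAbs)⁻¹ * y - (r k.natAbs)⁻¹ * k) = w y := by
          intro y hy
          rw [hwk (k := k) (by
            rw [abs_le]; constructor <;> linarith [hx.1, hx.2, hy.1, hy.2])]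
          simp only [hF, mul_sub]
        have h0 := inv_pos.2 (hr0 k.natAbs)
        refine RHOn.congr ?_ hab.le hsub
        exact RHOn.comp_mul_sub h0 ((hf _).rh 0 _ _ (by gcongr))
      · push Not at hmeet
        have hone : ∀ x ∈ Ioc a b, (1 : ℝ) = w x := by
          intro x hx
          exact (hFout _ _ (hmeet _ x hx)).symm
        refine RHOn.congr ?_ hab.le hone
        have : (b - a) / (b - a) = 1 := div_self (by linarith)
        simp [RHOn, this, hK.le]
  · have h0 := hr0 j
    have hab : (j - r j / 2 : ℝ) < j + r j / 2 := by linarith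
    have hmom : ∀ q : ℝ, ∫ x in (j - r j / 2 : ℝ)..(j + r j / 2), w x ^ q =
        r j * (l j ^ q * m j q) := by
      intro q
      have e : ∀ x ∈ uIoc (j - r j / 2 : ℝ) (j + r j / 2),
          w x ^ q = l j ^ q * f j ((r j)⁻¹ * x - (r j)⁻¹ * j) ^ q := by
        intro x hx
        rw [uIoc_of_le hab.le] at hx
        rw [← Real.mul_rpow (hl0 j).le (by linarith [(hf j).one_le ((r j)⁻¹ * x - (r j)⁻¹ * j)]),
          hwk (k := j) (by
            rw [Int.cast_natCast, abs_le]
            constructor <;> linarith [hx.1, hx.2, hr1 j])]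
        simp only [hF, Int.natAbs_natCast, Int.cast_natCast, mul_sub]
        rw [pulse, if_pos]
        rw [CharP.cast_eq_zero, zero_add, mem_Ioc, ← mul_sub, ← div_eq_inv_mul, lt_div_iff₀ h0,
          div_le_iff₀ h0]
        constructor <;> linarith [hx.1, hx.2]
      have hm := (hf j).moment 0 q
      rw [intervalIntegral.integral_congr_ae (Eventually.of_forall e),
        intervalIntegral.integral_const_mul,
        intervalIntegral.integral_comp_mul_sub (fun y => f j y ^ q) (inv_pos.2 h0).ne',
        show (r j)⁻¹ * (j - r j / 2) - (r j)⁻¹ * j = ((0 : ℤ) : ℝ) - 1 / 2 by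
          push_cast; field_simp; ring,
        show (r j)⁻¹ * (j + r j / 2) - (r j)⁻¹ * j = ((0 : ℤ) : ℝ) + 1 / 2 by
          push_cast; field_simp; ring, hm, smul_eq_mul, inv_inv]
      ring
    refine ⟨_, _, hab, fun q hq => ?_⟩
    have hm1 := hmom 1
    simp only [Real.rpow_one] at hm1
    rw [RHChar, intAvg_eq hab, intAvg_eq hab, hmom q, hm1,
      show (j + r j / 2 - (j - r j / 2) : ℝ) = r j by ring, mul_div_cancel_left₀ _ h0.ne',
      mul_div_cancel_left₀ _ h0.ne', Real.mul_rpow (Real.rpow_nonneg (hl0 j).le q)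
        ((hf j).moment_pos q).le, ← Real.rpow_mul (hl0 j).le, mul_one_div_cancel hq.ne',
      Real.rpow_one, mul_inv]
    have := (hl0 j).ne'
    field_simp

/-- Sharpness of the range `1 ≤ q < 1/s⁺_p(Q)` in `RH_p ⊂ RH_q` on the
real line: there is a weight with `[w]_{RH_p} = Q` and `[w]_{RH_{q₀}} = ∞` for
`q₀ = 1/s⁺_p(Q)`. -/
theorem RHp_to_RHq_sharpness
    (p Q : ℝ) (hp : 1 < p) (hQ : 1 < Q)
    (sp : ℝ) (hsp_mem : sp ∈ Icc (0:ℝ) (1 / p))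
    (hsp : (1 - p * sp) ^ (1 / p) * (1 - sp)⁻¹ = 1 / Q)
    (q₀ : ℝ) (hq₀ : q₀ = 1 / sp) :
    ∃ w : ℝ → ℝ, Measurable w ∧ (∀ᵐ x ∂(volume : Measure ℝ), 0 < w x) ∧
      MemRH w p Q ∧
      (∀ Q' : ℝ, Q' < Q → ∃ a b : ℝ, a < b ∧ Q' < RHChar w p a b) ∧
      ¬ ∃ C : ℝ, MemRH w q₀ C := by
  have hp0 : 0 < p := by linarith
  have hQ0 : 0 < Q := by linarith
  have hs0 : 0 < sp := by
    refine lt_of_le_of_ne hsp_mem.1 fun h => ?_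
    rw [← h] at hsp
    simp at hsp
    linarith
  have hps : p * sp < 1 := by
    have h1 : p * sp ≤ 1 := by
      have := (le_div_iff₀ hp0).1 hsp_mem.2
      linarith
    refine lt_of_le_of_ne h1 fun h => ?_
    rw [h, sub_self, Real.zero_rpow (by positivity), zero_mul] at hsp
    exact (one_div_pos.2 hQ0).ne hsp
  have hs1 : 0 < 1 - sp := by nlinarith
  have hKs : Q ^ p * (1 - p * sp) = (1 - sp) ^ p := by
    have h1 : Q * (1 - p * sp) ^ (1 / p) = 1 - sp := by
      field_simp at hsp
      linarith
    rw [← h1, Real.mul_rpow hQ0.le (Real.rpow_nonneg (by linarith) _),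
      ← Real.rpow_mul (by linarith), one_div_mul_cancel hp0.ne', Real.rpow_one]
  have hex : ∀ j : ℕ, ∃ l m f, 1 < l ∧ IsCellular p (Q ^ p) l m f ∧
      ((j + 1 : ℝ) / (j + 2)) * Q < m p ^ (1 / p) * (m 1)⁻¹ ∧
      (j + 1 : ℝ) < m (1 / sp) ^ (1 / (1 / sp)) * (m 1)⁻¹ := fun j =>
    exists_isCellular_sharp hp hQ hs0 hps hKs (by positivity)
      ((div_lt_one (by positivity)).2 (by linarith)) (by positivity)
  choose l m f hl hf hmp hmq using hex
  obtain ⟨w, hwm, hw1, hwi, hrh, hchar⟩ :=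
    exists_weight_of_isCellular hp0 (Real.one_lt_rpow hQ hp0) hl hf
  refine ⟨w, hwm, Eventually.of_forall fun x => by linarith [hw1 x], fun a b hab => ⟨?_, ?_, ?_⟩,
    fun Q' hQ' => ?_, ?_⟩
  · have := (hwi 1 a b).1.mono_set Ioo_subset_Ioc_self
    simpa using this
  · exact (hwi p a b).1.mono_set Ioo_subset_Ioc_self
  · have h := hrh a b hab
    rw [RHOn] at h
    rw [RHChar, intAvg_eq hab, intAvg_eq hab]
    have hba : 0 < b - a := sub_pos.2 hab
    have hU : 0 < (∫ x in a..b, w x) / (b - a) := by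
      refine div_pos (intervalIntegral.intervalIntegral_pos_of_pos (by simpa using hwi 1 a b)
        (fun x => by linarith [hw1 x]) hab) hba
    have hV : 0 ≤ (∫ x in a..b, w x ^ p) / (b - a) :=
      div_nonneg (intervalIntegral.integral_nonneg hab.le fun x _ =>
        Real.rpow_nonneg (by linarith [hw1 x]) p) hba.le
    rw [← div_eq_mul_inv, div_le_iff₀ hU]
    have h2 := Real.rpow_le_rpow hV h (show 0 ≤ 1 / p by positivity)
    rwa [← Real.mul_rpow hQ0.le hU.le, ← Real.rpow_mul (by positivity),
      mul_one_div_cancel hp0.ne', Real.rpow_one] at h2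
  · have hlim : Tendsto (fun j : ℕ => ((j + 1 : ℝ) / (j + 2)) * Q) atTop (nhds (1 * Q)) := by
      have h := tendsto_add_mul_div_add_mul_atTop_nhds (1 : ℝ) 2 1 (d := 1) one_ne_zero
      refine Tendsto.mul_const Q ?_
      rw [div_one] at h
      refine h.congr fun j => ?_
      rw [one_mul, add_comm (1 : ℝ), add_comm (2 : ℝ)]
    rw [one_mul] at hlim
    obtain ⟨j, hj⟩ := (hlim.eventually_const_lt hQ').exists
    obtain ⟨a, b, hab, h⟩ := hchar j
    exact ⟨a, b, hab, by rw [h p hp0]; exact hj.trans (hmp j)⟩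
  · rintro ⟨C, hC⟩
    obtain ⟨j, hj⟩ := exists_nat_ge C
    obtain ⟨a, b, hab, h⟩ := hchar j
    have h1 := (hC a b hab).2.2
    rw [hq₀, h _ (by positivity)] at h1
    linarith [hmq j]
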